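/- arXiv:2304.14686 — 2 statements merged into one kernel-verified Lean document; each statement's English description precedes it below -/
import Mathlib

section
/- Let Λ be the lattice with basis (x, y, z) whose Gram matrix with respect to (x, y, z) is [[−4, 3, 3], [3, −2, 0], [3, 0, −2]]. Let τ ∈ O(Λ) be the isometry with τ(x) = x, τ(y) = z, τ(z) = y, and let G = ⟨τ⟩. Then Λ^G is a lattice generated by x and y + z, and the image of W(Λ)^G under the restriction map res : O(Λ, Λ^G) → O(Λ^G), σ ↦ σ|_{Λ^G}, is not a normal subgroup of O(Λ^G). -/
open Matrix

/-- The Gram matrix `[[-4,3,3],[3,-2,0],[3,0,-2]]`. -/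
def gram : Matrix (Fin 3) (Fin 3) ℤ := !![-4, 3, 3; 3, -2, 0; 3, 0, -2]

/-- The bilinear form on `ℤ³` with Gram matrix `gram` w.r.t. the standard
basis `(x, y, z)`. -/
def bil (v w : Fin 3 → ℤ) : ℤ := v ⬝ᵥ gram.mulVec w

/-- The basis vectors x, y, z and d = y + z. -/
def xv : Fin 3 → ℤ := ![1, 0, 0]
def yv : Fin 3 → ℤ := ![0, 1, 0]
def zv : Fin 3 → ℤ := ![0, 0, 1]
def dv : Fin 3 → ℤ := yv + zv

/-- The submodule generated by x and d = y + z. -/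
def fixedLat : Submodule ℤ (Fin 3 → ℤ) := Submodule.span ℤ {xv, dv}

/-- The Weyl group of the lattice: the subgroup of automorphisms generated by
the reflections σ_w with w² = −2. -/
def weyl : Subgroup ((Fin 3 → ℤ) ≃ₗ[ℤ] (Fin 3 → ℤ)) :=
  Subgroup.closure
    {f : (Fin 3 → ℤ) ≃ₗ[ℤ] (Fin 3 → ℤ) |
      ∃ w : Fin 3 → ℤ, bil w w = -2 ∧ ∀ v : Fin 3 → ℤ, f v = v + bil v w • w}

/-- The image of W(Λ)^G (G = ⟨τ⟩) under the restriction map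
O(Λ, Λ^G) → O(Λ^G), σ ↦ σ|_{Λ^G}: those automorphisms of Λ^G that are the
restriction of some σ ∈ W(Λ) commuting with every element of G. -/
def resImage (τ : (Fin 3 → ℤ) ≃ₗ[ℤ] (Fin 3 → ℤ)) :
    Set (fixedLat ≃ₗ[ℤ] fixedLat) :=
  {g : fixedLat ≃ₗ[ℤ] fixedLat |
    ∃ σ ∈ weyl, (∀ t ∈ Subgroup.zpowers τ, t * σ * t⁻¹ = σ) ∧
      ∀ u : fixedLat, (g u : Fin 3 → ℤ) = σ (u : Fin 3 → ℤ)}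

lemma bil_apply (v w : Fin 3 → ℤ) :
    bil v w = v 0 * (-4 * w 0 + 3 * w 1 + 3 * w 2) + v 1 * (3 * w 0 - 2 * w 1)
      + v 2 * (3 * w 0 - 2 * w 2) := by
  simp [bil, _root_.gram, dotProduct, mulVec, Fin.sum_univ_three]
  ring

lemma mem_fixedLat {v : Fin 3 → ℤ} : v ∈ fixedLat ↔ v 1 = v 2 := by
  rw [fixedLat, Submodule.mem_span_pair]
  constructor
  · rintro ⟨a, b, rfl⟩
    simp [xv, dv, yv, zv]
  · intro h
    refine ⟨v 0, v 1, ?_⟩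
    ext i
    fin_cases i <;> simp [xv, dv, yv, zv, h]

lemma xv_mem_fixedLat : xv ∈ fixedLat := Submodule.subset_span (by simp)

lemma dv_mem_fixedLat : dv ∈ fixedLat := Submodule.subset_span (by simp)

/-- The reflection in a vector `w` with `w² = -2`. -/
def weylReflection (w : Fin 3 → ℤ) (hw : bil w w = -2) :
    (Fin 3 → ℤ) ≃ₗ[ℤ] (Fin 3 → ℤ) :=
  LinearEquiv.ofInvolutive
    { toFun := fun v => v + bil v w • w
      map_add' := fun u v => by
        ext i
        simp only [bil_apply, Pi.add_apply, Pi.smul_apply, smul_eq_mul]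
        ring
      map_smul' := fun c v => by
        ext i
        simp only [bil_apply, Pi.add_apply, Pi.smul_apply, smul_eq_mul, RingHom.id_apply]
        ring }
    (fun v => by
      have key : bil (v + bil v w • w) w = bil v w + bil v w * bil w w := by
        simp only [bil_apply, Pi.add_apply, Pi.smul_apply, smul_eq_mul]
        ring
      ext i
      simp only [LinearMap.coe_mk, AddHom.coe_mk, key, hw, Pi.add_apply, Pi.smul_apply,
        smul_eq_mul]
      ring)

lemma weylReflection_apply (w : Fin 3 → ℤ) (hw : bil w w = -2) (v : Fin 3 → ℤ) :
    weylReflection w hw v = v + bil v w • w := rfl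

lemma weylReflection_mem_weyl (w : Fin 3 → ℤ) (hw : bil w w = -2) :
    weylReflection w hw ∈ weyl :=
  Subgroup.subset_closure ⟨w, hw, weylReflection_apply w hw⟩

lemma bil_yv_self : bil yv yv = -2 := by simp [bil_apply, yv]

lemma bil_zv_self : bil zv zv = -2 := by simp [bil_apply, zv]

/-- The product of the commuting reflections in `y` and `z`. -/
def reflYZ : (Fin 3 → ℤ) ≃ₗ[ℤ] (Fin 3 → ℤ) :=
  weylReflection yv bil_yv_self * weylReflection zv bil_zv_self

lemma reflYZ_apply (v : Fin 3 → ℤ) :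
    reflYZ v = ![v 0, 3 * v 0 - v 1, 3 * v 0 - v 2] := by
  ext i
  simp only [reflYZ, LinearEquiv.mul_apply, weylReflection_apply, bil_apply, Pi.add_apply,
    Pi.smul_apply, smul_eq_mul]
  fin_cases i <;> simp [yv, zv] <;> ring

lemma reflYZ_mem_weyl : reflYZ ∈ weyl :=
  mul_mem (weylReflection_mem_weyl _ _) (weylReflection_mem_weyl _ _)

/-- The restriction of `reflYZ` to the fixed lattice, i.e. the reflection in `d = y + z`. -/
def fixedLatRefl : fixedLat ≃ₗ[ℤ] fixedLat :=
  LinearEquiv.ofInvolutive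
    (reflYZ.toLinearMap.restrict (p := fixedLat) (q := fixedLat) fun v hv => by
      rw [mem_fixedLat] at hv ⊢
      simp [reflYZ_apply, hv])
    (fun v => by
      ext i
      fin_cases i <;> simp [LinearMap.restrict_apply, reflYZ_apply])

lemma coe_fixedLatRefl (u : fixedLat) :
    (fixedLatRefl u : Fin 3 → ℤ) = reflYZ (u : Fin 3 → ℤ) := rfl

/-- The isometry of the fixed lattice exchanging `x` and `d = y + z`. -/
def fixedLatSwap : fixedLat ≃ₗ[ℤ] fixedLat :=
  LinearEquiv.ofInvolutive
    { toFun := fun v => ⟨![v.1 1, v.1 0, v.1 0], by simp [mem_fixedLat]⟩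
      map_add' := fun u v => by
        ext i
        fin_cases i <;> simp
      map_smul' := fun c v => by
        ext i
        fin_cases i <;> simp }
    (fun v => by
      have hv := mem_fixedLat.1 v.2
      ext i
      fin_cases i <;> simp [hv])

lemma coe_fixedLatSwap (u : fixedLat) :
    (fixedLatSwap u : Fin 3 → ℤ) = ![u.1 1, u.1 0, u.1 0] := rfl

lemma bil_fixedLatSwap (u v : fixedLat) :
    bil (fixedLatSwap u : Fin 3 → ℤ) (fixedLatSwap v : Fin 3 → ℤ)
      = bil (u : Fin 3 → ℤ) (v : Fin 3 → ℤ) := by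
  have hu := mem_fixedLat.1 u.2
  have hv := mem_fixedLat.1 v.2
  simp [bil_apply, coe_fixedLatSwap, ← hu, ← hv]
  ring

lemma fixedLatRefl_mem_resImage {τ : (Fin 3 → ℤ) ≃ₗ[ℤ] (Fin 3 → ℤ)}
    (hτ : ∀ v : Fin 3 → ℤ, τ v = ![v 0, v 2, v 1]) : fixedLatRefl ∈ resImage τ := by
  refine ⟨reflYZ, reflYZ_mem_weyl, ?_, coe_fixedLatRefl⟩
  have hcomm : Commute τ reflYZ := by
    refine LinearEquiv.ext fun v => ?_
    simp [LinearEquiv.mul_apply, hτ, reflYZ_apply]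
  rintro t ⟨n, rfl⟩
  exact mul_inv_eq_iff_eq_mul.2 (hcomm.zpow_left n)

/-- If `g` is the restriction of `σ`, then `g d = σ y + τ (σ y)`, whose `x`-coordinate
is even. -/
lemma even_apply_dv_of_mem_resImage {τ : (Fin 3 → ℤ) ≃ₗ[ℤ] (Fin 3 → ℤ)}
    (hτ : ∀ v : Fin 3 → ℤ, τ v = ![v 0, v 2, v 1]) {g : fixedLat ≃ₗ[ℤ] fixedLat}
    (hg : g ∈ resImage τ) : Even ((g ⟨dv, dv_mem_fixedLat⟩ : Fin 3 → ℤ) 0) := by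
  obtain ⟨σ, -, hσ, hgσ⟩ := hg
  have hcomm : τ * σ = σ * τ :=
    mul_inv_eq_iff_eq_mul.1 (hσ τ (Subgroup.mem_zpowers τ))
  have hyz : τ yv = zv := by simp [hτ, yv, zv]
  have hσz : σ zv = τ (σ yv) := by
    rw [← hyz]
    exact (LinearEquiv.congr_fun hcomm yv).symm
  refine ⟨σ yv 0, ?_⟩
  have hd : σ dv = σ yv + τ (σ yv) := by rw [dv, map_add, hσz]
  rw [hgσ, hd, hτ]
  simp

/-- Let Λ = ℤ³ with Gram matrix [[−4,3,3],[3,−2,0],[3,0,−2]]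
w.r.t. (x,y,z), τ ∈ O(Λ) the isometry swapping y and z, and G = ⟨τ⟩. Then
Λ^G is a lattice generated by x and y + z (the fixed set is the span of
{x, y+z} and the restricted form is non-degenerate), and the image of W(Λ)^G
under the restriction map res : O(Λ, Λ^G) → O(Λ^G) is not a normal subgroup
of O(Λ^G). -/
theorem image_of_weyl_not_normal
    (τ : (Fin 3 → ℤ) ≃ₗ[ℤ] (Fin 3 → ℤ))
    (hτ : ∀ v : Fin 3 → ℤ, τ v = ![v 0, v 2, v 1]) :
    ({v : Fin 3 → ℤ | ∀ g ∈ Subgroup.zpowers τ, g v = v}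
      = (fixedLat : Set (Fin 3 → ℤ))) ∧
    (∀ v ∈ fixedLat, v ≠ 0 → ∃ w ∈ fixedLat, bil v w ≠ 0) ∧
    ¬ (∀ h : fixedLat ≃ₗ[ℤ] fixedLat,
        (∀ u v : fixedLat, bil (h u : Fin 3 → ℤ) (h v : Fin 3 → ℤ)
          = bil (u : Fin 3 → ℤ) (v : Fin 3 → ℤ)) →
        ∀ g ∈ resImage τ, h * g * h⁻¹ ∈ resImage τ) := by
  refine ⟨?_, ?_, ?_⟩
  · ext v
    simp only [Set.mem_ofPred_eq, SetLike.mem_coe, mem_fixedLat]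
    constructor
    · intro h
      have := congrFun (h τ (Subgroup.mem_zpowers τ)) 2
      simpa [hτ] using this
    · intro h g hg
      have hfix : τ ∈ MulAction.stabilizer ((Fin 3 → ℤ) ≃ₗ[ℤ] (Fin 3 → ℤ)) v := by
        rw [MulAction.mem_stabilizer_iff, LinearEquiv.smul_def, hτ]
        ext i
        fin_cases i <;> simp [h]
      exact MulAction.mem_stabilizer_iff.1 (Subgroup.zpowers_le.2 hfix hg)
  · intro v hv hv0
    by_contra! h
    have hx := h xv xv_mem_fixedLat
    have hd := h dv dv_mem_fixedLat
    rw [mem_fixedLat] at hv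
    simp [bil_apply, xv, dv, yv, zv] at hx hd
    apply hv0
    ext i
    fin_cases i <;> simp <;> omega
  · intro h
    have heven := even_apply_dv_of_mem_resImage hτ
      (h fixedLatSwap bil_fixedLatSwap fixedLatRefl (fixedLatRefl_mem_resImage hτ))
    have hinv : fixedLatSwap⁻¹ ⟨dv, dv_mem_fixedLat⟩ = ⟨xv, xv_mem_fixedLat⟩ := by
      refine (LinearEquiv.symm_apply_eq fixedLatSwap).2 (Subtype.ext ?_)
      simp [coe_fixedLatSwap, xv, dv, yv, zv]
    rw [LinearEquiv.mul_apply, LinearEquiv.mul_apply, hinv, coe_fixedLatSwap,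
      coe_fixedLatRefl, reflYZ_apply] at heven
    simp [xv] at heven
    exact absurd heven (by decide)
end

section
/- Let Λ' be an even lattice of rank 3, and suppose x, y, z ∈ Λ' are ℤ-linearly independent elements whose Gram matrix is [[−4, 3, 3], [3, −2, 0], [3, 0, −2]] (a lattice of discriminant 20). Then x, y, z generate Λ'; i.e., the sublattice they span equals Λ'. -/
/-- The discriminant form of the Gram matrix `[[-4, 3, 3], [3, -2, 0], [3, 0, -2]]` has no nonzero
isotropic element: if `(p, q, r)` represents a dual vector of even integral norm, then it is the
image of an integral vector. -/
theorem exists_preimage_of_even_norm (p q r k : ℤ)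
    (h : 4 * p ^ 2 + 12 * p * q + 12 * p * r - q ^ 2 - r ^ 2 + 18 * q * r = 40 * k) :
    ∃ a b c : ℤ, 4 * p + 6 * q + 6 * r = 20 * a ∧ 6 * p - q + 9 * r = 20 * b ∧
      6 * p + 9 * q - r = 20 * c := by
  have hqr : (2 : ℤ) ∣ q - r := by
    refine Int.prime_two.dvd_of_dvd_pow (n := 2)
      ⟨2 * p ^ 2 + 6 * p * q + 6 * p * r + 8 * q * r - 20 * k, ?_⟩
    linear_combination -h
  obtain ⟨s, hs⟩ := hqr
  obtain rfl : q = r + 2 * s := by omega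
  have hps : (2 : ℤ) ∣ p - s := by
    refine Int.prime_two.dvd_of_dvd_pow (n := 2)
      ⟨5 * k - 3 * p * r - 4 * p * s - 2 * r ^ 2 - 4 * r * s + s ^ 2, ?_⟩
    linarith
  have hprs : (5 : ℤ) ∣ p + 3 * (r + s) := by
    refine (by norm_num : Prime (5 : ℤ)).dvd_of_dvd_pow (n := 2)
      ⟨2 * k + r ^ 2 + 2 * r * s + 2 * s ^ 2, ?_⟩
    linarith
  exact ⟨(4 * p + 6 * (r + 2 * s) + 6 * r) / 20, (6 * p - (r + 2 * s) + 9 * r) / 20,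
    (6 * p + 9 * (r + 2 * s) - r) / 20, by omega, by omega, by omega⟩


/-- Let Λ' be an even lattice of rank 3 and let x, y, z ∈ Λ' be
ℤ-linearly independent elements whose Gram matrix is
[[−4,3,3],[3,−2,0],[3,0,−2]] (a lattice of discriminant 20). Then x, y, z
generate Λ': the sublattice they span equals Λ'. -/
theorem even_overlattice_is_equal
    (Λ' : Type) [AddCommGroup Λ'] [Module ℤ Λ']
    [Module.Free ℤ Λ'] [Module.Finite ℤ Λ']
    (B : Λ' →ₗ[ℤ] Λ' →ₗ[ℤ] ℤ)
    (hsymm : ∀ v u : Λ', B v u = B u v)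
    (hnd : ∀ v : Λ', (∀ u : Λ', B v u = 0) → v = 0)
    (heven : ∀ v : Λ', Even (B v v))
    (hrank : Module.finrank ℤ Λ' = 3)
    (x y z : Λ')
    (hli : LinearIndependent ℤ ![x, y, z])
    (hgram : ∀ i j : Fin 3,
      B (![x, y, z] i) (![x, y, z] j) = !![-4, 3, 3; 3, -2, 0; 3, 0, -2] i j) :
    Submodule.span ℤ {x, y, z} = ⊤ := by
  obtain rfl : ‹Module ℤ Λ'› = AddCommGroup.toIntModule Λ' := Subsingleton.elim _ _
  have hxx : B x x = -4 := by simpa using hgram 0 0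
  have hxy : B x y = 3 := by simpa using hgram 0 1
  have hxz : B x z = 3 := by simpa using hgram 0 2
  have hyx : B y x = 3 := by simpa using hgram 1 0
  have hyy : B y y = -2 := by simpa using hgram 1 1
  have hyz : B y z = 0 := by simpa using hgram 1 2
  have hzx : B z x = 3 := by simpa using hgram 2 0
  have hzy : B z y = 0 := by simpa using hgram 2 1
  have hzz : B z z = -2 := by simpa using hgram 2 2
  have eq_zero_of_orthogonal : ∀ w : Λ', B w x = 0 → B w y = 0 → B w z = 0 → w = 0 := by
    intro w hwx hwy hwz
    have hdep : ¬ LinearIndependent ℤ ![w, x, y, z] := fun h => by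
      have := h.fintype_card_le_finrank
      simp [hrank] at this
    obtain ⟨g, hg, i, hi⟩ := Fintype.not_linearIndependent_iff.mp hdep
    replace hg : g 0 • w + g 1 • x + g 2 • y + g 3 • z = 0 := by
      simpa [Fin.sum_univ_four] using hg
    have hx := congrArg (fun u => B u x) hg
    have hy := congrArg (fun u => B u y) hg
    have hz := congrArg (fun u => B u z) hg
    simp only [map_add, map_smul, map_zero, LinearMap.add_apply, LinearMap.smul_apply,
      LinearMap.zero_apply, smul_eq_mul, hwx, hwy, hwz, hxx, hxy, hxz, hyx, hyy, hyz, hzx, hzy,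
      hzz] at hx hy hz
    have h1 : g 1 = 0 := by omega
    have h2 : g 2 = 0 := by omega
    have h3 : g 3 = 0 := by omega
    have h0 : g 0 ≠ 0 := fun h0 => hi (by fin_cases i <;> assumption)
    rw [h1, h2, h3] at hg
    simp only [zero_smul, add_zero] at hg
    exact (smul_eq_zero.mp hg).resolve_left h0
  rw [eq_top_iff]
  intro v _
  have hv : (20 : ℤ) • v - (4 * B v x + 6 * B v y + 6 * B v z) • x
      - (6 * B v x - B v y + 9 * B v z) • y - (6 * B v x + 9 * B v y - B v z) • z = 0 := by
    apply eq_zero_of_orthogonal <;>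
    · simp only [map_sub, map_smul, LinearMap.sub_apply, LinearMap.smul_apply, smul_eq_mul,
        hxx, hxy, hxz, hyx, hyy, hyz, hzx, hzy, hzz]
      ring
  obtain ⟨k, hk⟩ := heven v
  have hnorm := congrArg (fun u => B u v) hv
  simp only [map_sub, map_smul, map_zero, LinearMap.sub_apply, LinearMap.smul_apply,
    LinearMap.zero_apply, smul_eq_mul, hk, hsymm x v, hsymm y v, hsymm z v] at hnorm
  obtain ⟨a, b, c, ha, hb, hc⟩ :=
    exists_preimage_of_even_norm (B v x) (B v y) (B v z) k (by linear_combination -hnorm)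
  have hvabc : v - a • x - b • y - c • z = 0 := by
    apply eq_zero_of_orthogonal <;>
    · simp only [map_sub, map_smul, LinearMap.sub_apply, LinearMap.smul_apply, smul_eq_mul,
        hxx, hxy, hxz, hyx, hyy, hyz, hzx, hzy, hzz]
      omega
  rw [Submodule.mem_span_triple]
  refine ⟨a, b, c, ?_⟩
  rw [← sub_eq_zero, ← neg_eq_zero, ← hvabc]
  abel
end
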